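/- Let G be a finite simple graph, let S be a good independent set of G all of whose vertices have degree at most 9 in G, let i ∈ {4,5,6,7,8,9}, and let v be a vertex of G with v ∉ V(H_i) and j := deg_G(v) ∈ {4,…,i}, such that v has at most two neighbours in each connected component of H_i. Then S' := Ŝ_j ∪ {v} is a good independent set of G all of whose vertices have degree at most 9, and φ(S') ≻ φ(S). -/

import Mathlib

open SimpleGraph

variable {V : Type*}

/-- `Gv G v` is the subgraph of `G` induced by `{v} ∪ N_G(v)`. -/
def Gv (G : SimpleGraph V) (v : V) : G.Subgraph :=
  (⊤ : G.Subgraph).induce ({v} ∪ G.neighborSet v)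

/-- Two subgraphs of `G` are compatible if they have at most two vertices in common. -/
def Compatible (G : SimpleGraph V) (H₁ H₂ : G.Subgraph) : Prop :=
  (H₁.verts ∩ H₂.verts).ncard ≤ 2

/-- Binary trees whose leaves are labelled by vertices. -/
inductive RepTree (V : Type*) where
  | leaf : V → RepTree V
  | node : RepTree V → RepTree V → RepTree V

namespace RepTree

/-- The list of (labels of) leaves of a binary tree. -/
def leaves : RepTree V → List V
  | leaf v => [v]
  | node a b => leaves a ++ leaves b

/-- The subgraph `G⟨x⟩` associated with a node `x`, given the assignment `f` of
subgraphs to leaves: the union of the subgraphs at the leaves below `x`. -/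
def graphOf (G : SimpleGraph V) (f : V → G.Subgraph) : RepTree V → G.Subgraph
  | leaf v => f v
  | node a b => graphOf G f a ⊔ graphOf G f b

/-- The tree, with subgraphs assigned to its leaves by `f`, is a tree
representation in `G`: the subgraphs `G⟨a⟩` and `G⟨b⟩` are compatible whenever
`a` and `b` are children of a common node. -/
def IsRep (G : SimpleGraph V) (f : V → G.Subgraph) : RepTree V → Prop
  | leaf _ => True
  | node a b => IsRep G f a ∧ IsRep G f b ∧ Compatible G (graphOf G f a) (graphOf G f b)

/-- `IsNode x T` means that `x` is (the subtree rooted at) a node of `T`. -/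
inductive IsNode : RepTree V → RepTree V → Prop
  | refl (t : RepTree V) : IsNode t t
  | left {x a b : RepTree V} : IsNode x a → IsNode x (node a b)
  | right {x a b : RepTree V} : IsNode x b → IsNode x (node a b)

end RepTree

variable [Fintype V] [DecidableEq V]

/-- `Ŝ_i = S_4 ∪ ⋯ ∪ S_i`, the set of vertices of `S` whose degree lies in `[4, i]`. -/
def Shat (G : SimpleGraph V) [DecidableRel G.Adj] (S : Finset V) (i : ℕ) : Finset V :=
  S.filter fun v => 4 ≤ G.degree v ∧ G.degree v ≤ i

/-- `H_i := ⋃_{v ∈ Ŝ_i} G_v`. -/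
def Hsub (G : SimpleGraph V) [DecidableRel G.Adj] (S : Finset V) (i : ℕ) : G.Subgraph :=
  ⨆ v ∈ Shat G S i, Gv G v

/-- `C` is a connected component of `H`: a maximal connected subgraph of `H`. -/
def IsComponent (G : SimpleGraph V) (H C : G.Subgraph) : Prop :=
  C.Connected ∧ C ≤ H ∧ ∀ D : G.Subgraph, C ≤ D → D ≤ H → D.Connected → D = C

/-- `S` is good: there is a tree representation `(T, {G_u : u ∈ S})` respecting `S`
such that for every `i ∈ [4,9]` and every connected component `X` of `H_i` there is
a node `x` of `T` with `X = G⟨x⟩`. -/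
def IsGood (G : SimpleGraph V) [DecidableRel G.Adj] (S : Finset V) : Prop :=
  ∃ T : RepTree V, T.leaves.Nodup ∧ T.leaves.toFinset = S ∧
    RepTree.IsRep G (Gv G) T ∧
    ∀ i : ℕ, 4 ≤ i → i ≤ 9 → ∀ X : G.Subgraph, IsComponent G (Hsub G S i) X →
      ∃ x : RepTree V, RepTree.IsNode x T ∧ RepTree.graphOf G (Gv G) x = X

/-- `φ(S) = (|S_4|, |S_5|, …, |S_9|)`. -/
def phi (G : SimpleGraph V) [DecidableRel G.Adj] (S : Finset V) : Fin 6 → ℕ :=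
  fun k => (S.filter fun v => G.degree v = k.1 + 4).card

/-- Strict lexicographic order on the vectors `φ(S)`. -/
def PhiGT (a b : Fin 6 → ℕ) : Prop :=
  ∃ j : Fin 6, (∀ k : Fin 6, k < j → a k = b k) ∧ b j < a j

/-- `⪰` : strict lexicographic order or equality. -/
def PhiGE (a b : Fin 6 → ℕ) : Prop := PhiGT a b ∨ a = b

section Subgraphs

variable {α : Type*} {G : SimpleGraph α}

theorem mem_Gv_verts {u p : α} : p ∈ (Gv G u).verts ↔ p = u ∨ G.Adj u p := by
  simp [Gv]

theorem self_mem_Gv (u : α) : u ∈ (Gv G u).verts := mem_Gv_verts.2 (Or.inl rfl)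

theorem eq_of_mem_Gv {S : Finset α} (hindep : ∀ u ∈ S, ∀ w ∈ S, ¬ G.Adj u w) {u w : α}
    (hu : u ∈ S) (hw : w ∈ S) (h : u ∈ (Gv G w).verts) : u = w :=
  (mem_Gv_verts.1 h).resolve_right (hindep w hw u hu)

theorem Gv_connected (u : α) : (Gv G u).Connected := by
  rw [Subgraph.connected_iff', connected_iff_exists_forall_reachable]
  refine ⟨⟨u, self_mem_Gv u⟩, ?_⟩
  rintro ⟨p, hp⟩
  rcases mem_Gv_verts.1 hp with rfl | h
  · exact Reachable.refl _
  · refine Adj.reachable ?_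
    simp [Gv, h]

theorem connected_verts_nonempty {X : G.Subgraph} (hX : X.Connected) : X.verts.Nonempty :=
  (Subgraph.connected_iff.1 hX).2

theorem sup_connected {A B : G.Subgraph} (hA : A.Connected) (hB : B.Connected) {p : α}
    (hpA : p ∈ A.verts) (hpB : p ∈ B.verts) : (A ⊔ B).Connected :=
  Subgraph.connected_sup hA.preconnected hB.preconnected ⟨p, hpA, hpB⟩

/-- A connected subgraph of the union of two vertex-disjoint subgraphs lies in the one it meets. -/
theorem le_left_of_connected_of_le_sup {A B X : G.Subgraph} (hX : X.Connected)
    (hle : X ≤ A ⊔ B) (hAB : Disjoint A.verts B.verts) {p : α} (hpX : p ∈ X.verts)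
    (hpA : p ∈ A.verts) : X ≤ A := by
  have hstep : ∀ a b, X.Adj a b → a ∈ A.verts → A.Adj a b := by
    intro a b hab ha
    rcases Subgraph.sup_adj.1 (hle.2 hab) with h | h
    · exact h
    · exact absurd (B.edge_vert h) (Set.disjoint_left.1 hAB ha)
  have hwalk : ∀ a b : X.verts, X.coe.Walk a b → (a : α) ∈ A.verts → (b : α) ∈ A.verts := by
    intro a b w
    induction w with
    | nil => exact id
    | cons h _ ih => exact fun ha => ih (A.edge_vert (hstep _ _ h ha).symm)
  have hverts : X.verts ⊆ A.verts := by
    intro q hq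
    obtain ⟨w⟩ := hX.preconnected ⟨p, hpX⟩ ⟨q, hq⟩
    exact hwalk _ _ w hpA
  exact ⟨hverts, fun a b hab => hstep a b hab (hverts (X.edge_vert hab))⟩

namespace IsComponent

theorem le_of_connected {H C D : G.Subgraph} (hC : IsComponent G H C) (hD : D.Connected)
    (hDH : D ≤ H) {p : α} (hpC : p ∈ C.verts) (hpD : p ∈ D.verts) : D ≤ C := by
  have h := hC.2.2 (C ⊔ D) le_sup_left (sup_le hC.2.1 hDH) (sup_connected hC.1 hD hpC hpD)
  exact h ▸ le_sup_right

theorem eq_of_mem {H C D : G.Subgraph} (hC : IsComponent G H C) (hD : IsComponent G H D)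
    {p : α} (hpC : p ∈ C.verts) (hpD : p ∈ D.verts) : C = D :=
  le_antisymm (hD.le_of_connected hC.1 hC.2.1 hpD hpC) (hC.le_of_connected hD.1 hD.2.1 hpC hpD)

end IsComponent

theorem exists_isComponent_ge [Finite α] {H D : G.Subgraph} (hD : D.Connected) (hDH : D ≤ H) :
    ∃ C, IsComponent G H C ∧ D ≤ C := by
  obtain ⟨C, hDC, hC⟩ := (Set.toFinite {K : G.Subgraph | K.Connected ∧ K ≤ H}).exists_le_maximal
    (show D ∈ {K : G.Subgraph | K.Connected ∧ K ≤ H} from ⟨hD, hDH⟩)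
  exact ⟨C, ⟨hC.prop.1, hC.prop.2, fun E hCE hEH hE => le_antisymm (hC.2 ⟨hE, hEH⟩ hCE) hCE⟩, hDC⟩

end Subgraphs

namespace RepTree

variable {α : Type*} {G : SimpleGraph α} {f : α → G.Subgraph}

theorem leaves_ne_nil (t : RepTree α) : t.leaves ≠ [] := by
  induction t with
  | leaf u => simp [leaves]
  | node a b iha _ => simp [leaves, iha]

theorem mem_verts_graphOf {t : RepTree α} {p : α} :
    p ∈ (graphOf G f t).verts ↔ ∃ u ∈ t.leaves, p ∈ (f u).verts := by
  induction t with
  | leaf u => simp [graphOf, leaves]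
  | node a b iha ihb => simp [graphOf, leaves, iha, ihb, or_and_right, exists_or]

namespace IsNode

theorem trans {x y z : RepTree α} (hxy : IsNode x y) (hyz : IsNode y z) : IsNode x z := by
  induction hyz with
  | refl => exact hxy
  | left _ ih => exact .left ih
  | right _ ih => exact .right ih

theorem sublist_leaves {x t : RepTree α} (h : IsNode x t) : x.leaves.Sublist t.leaves := by
  induction h with
  | refl => exact List.Sublist.refl _
  | left _ ih => exact ih.trans (List.sublist_append_left _ _)
  | right _ ih => exact ih.trans (List.sublist_append_right _ _)

theorem graphOf_le {x t : RepTree α} (h : IsNode x t) : graphOf G f x ≤ graphOf G f t := by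
  induction h with
  | refl => exact le_rfl
  | left _ ih => exact ih.trans le_sup_left
  | right _ ih => exact ih.trans le_sup_right

theorem isRep {x t : RepTree α} (h : IsNode x t) (ht : IsRep G f t) : IsRep G f x := by
  induction h with
  | refl => exact ht
  | left _ ih => exact ih ht.1
  | right _ ih => exact ih ht.2.1

/-- Two nodes of a tree with distinct leaves that lie above a common leaf are comparable. -/
theorem comparable {t x y : RepTree α} (ht : t.leaves.Nodup) (hx : IsNode x t)
    (hy : IsNode y t) {u : α} (hux : u ∈ x.leaves) (huy : u ∈ y.leaves) :
    IsNode x y ∨ IsNode y x := by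
  induction t with
  | leaf w =>
    cases hx
    exact Or.inr hy
  | node a b iha ihb =>
    have hd := List.nodup_append.1 ht
    cases hx with
    | refl => exact Or.inr hy
    | left hx =>
      cases hy with
      | refl => exact Or.inl (.left hx)
      | left hy => exact iha hd.1 hx hy
      | right hy =>
        exact absurd rfl (hd.2.2 _ (hx.sublist_leaves.subset hux) _ (hy.sublist_leaves.subset huy))
    | right hx =>
      cases hy with
      | refl => exact Or.inl (.right hx)
      | left hy =>
        exact absurd rfl (hd.2.2 _ (hy.sublist_leaves.subset huy) _ (hx.sublist_leaves.subset hux))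
      | right hy => exact ihb hd.2.1 hx hy

end IsNode

/-- The tree obtained from `t` by successively attaching the trees of a list at the root. -/
def attach (t : RepTree α) (l : List (RepTree α)) : RepTree α := l.foldl node t

theorem attach_append (t : RepTree α) (l m : List (RepTree α)) :
    attach t (l ++ m) = attach (attach t l) m := List.foldl_append

theorem isNode_attach (t : RepTree α) (l : List (RepTree α)) : IsNode t (attach t l) := by
  induction l generalizing t with
  | nil => exact .refl t
  | cons c l ih => exact (IsNode.left (.refl t)).trans (ih (node t c))

theorem isNode_attach_of_mem (t : RepTree α) {l : List (RepTree α)} {c : RepTree α}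
    (hc : c ∈ l) : IsNode c (attach t l) := by
  induction l generalizing t with
  | nil => simp at hc
  | cons d l ih =>
    rcases List.mem_cons.1 hc with rfl | hc
    · exact (IsNode.right (.refl c)).trans (isNode_attach (node t c) l)
    · exact ih (node t d) hc

theorem leaves_attach (t : RepTree α) (l : List (RepTree α)) :
    (attach t l).leaves = t.leaves ++ l.flatMap leaves := by
  induction l generalizing t with
  | nil => simp [attach]
  | cons c l ih =>
    have h := ih (node t c)
    simpa [attach, leaves] using h

theorem mem_verts_graphOf_attach {t : RepTree α} {l : List (RepTree α)} {p : α} :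
    p ∈ (graphOf G f (attach t l)).verts ↔
      p ∈ (graphOf G f t).verts ∨ ∃ c ∈ l, p ∈ (graphOf G f c).verts := by
  induction l generalizing t with
  | nil => simp [attach]
  | cons c l ih =>
    have h := ih (t := node t c)
    simpa [attach, graphOf, or_assoc] using h

theorem graphOf_attach_le {t : RepTree α} {l : List (RepTree α)} {K : G.Subgraph}
    (ht : graphOf G f t ≤ K) (hl : ∀ c ∈ l, graphOf G f c ≤ K) :
    graphOf G f (attach t l) ≤ K := by
  induction l generalizing t with
  | nil => exact ht
  | cons c l ih =>
    exact ih (t := node t c) (sup_le ht (hl c List.mem_cons_self))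
      fun d hd => hl d (List.mem_cons_of_mem _ hd)

theorem graphOf_attach_connected {t : RepTree α} {l : List (RepTree α)}
    (ht : (graphOf G f t).Connected) (hl : ∀ c ∈ l, (graphOf G f c).Connected ∧
      ∃ p ∈ (graphOf G f t).verts, p ∈ (graphOf G f c).verts) :
    (graphOf G f (attach t l)).Connected := by
  induction l generalizing t with
  | nil => exact ht
  | cons c l ih =>
    obtain ⟨hc, p, hpt, hpc⟩ := hl c List.mem_cons_self
    refine ih (t := node t c) (sup_connected ht hc hpt hpc) fun d hd => ?_
    obtain ⟨hd, q, hqt, hqd⟩ := hl d (List.mem_cons_of_mem _ hd)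
    exact ⟨hd, q, Or.inl hqt, hqd⟩

theorem isRep_attach {t : RepTree α} {l : List (RepTree α)} (ht : IsRep G f t)
    (hl : ∀ c ∈ l, IsRep G f c ∧ Compatible G (graphOf G f t) (graphOf G f c))
    (hdisj : l.Pairwise fun c d => Disjoint (graphOf G f c).verts (graphOf G f d).verts) :
    IsRep G f (attach t l) := by
  induction l generalizing t with
  | nil => exact ht
  | cons c l ih =>
    obtain ⟨hcl, hdisj⟩ := List.pairwise_cons.1 hdisj
    obtain ⟨hc, htc⟩ := hl c List.mem_cons_self
    refine ih (t := node t c) ⟨ht, hc, htc⟩ (fun d hd => ?_) hdisj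
    obtain ⟨hdr, htd⟩ := hl d (List.mem_cons_of_mem _ hd)
    refine ⟨hdr, ?_⟩
    unfold Compatible at htd ⊢
    rwa [graphOf, Subgraph.verts_sup, Set.union_inter_distrib_right, (hcl d hd).inter_eq,
      Set.union_empty]

/-- Nodes of a representation of an independent set whose graphs are nested are nested, up to
replacing the lower node by the upper one. -/
theorem exists_isNode_of_graphOf_le {S : Finset α}
    (hindep : ∀ u ∈ S, ∀ w ∈ S, ¬ G.Adj u w) {T x y : RepTree α} (hT : T.leaves.Nodup)
    (hTS : ∀ u ∈ T.leaves, u ∈ S) (hx : IsNode x T) (hy : IsNode y T)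
    (hxy : graphOf G (Gv G) x ≤ graphOf G (Gv G) y) :
    ∃ z, IsNode z y ∧ graphOf G (Gv G) z = graphOf G (Gv G) x := by
  obtain ⟨u, hu⟩ := List.exists_mem_of_ne_nil _ x.leaves_ne_nil
  obtain ⟨w, hw, huw⟩ := mem_verts_graphOf.1
    (hxy.1 (mem_verts_graphOf.2 ⟨u, hu, self_mem_Gv u⟩))
  obtain rfl := eq_of_mem_Gv hindep (hTS u (hx.sublist_leaves.subset hu))
    (hTS w (hy.sublist_leaves.subset hw)) huw
  rcases IsNode.comparable hT hx hy hu hw with h | h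
  · exact ⟨x, h, rfl⟩
  · exact ⟨y, .refl y, le_antisymm h.graphOf_le hxy⟩

end RepTree

section DegreeClasses

variable {α : Type*} [Fintype α] (G : SimpleGraph α) [DecidableRel G.Adj]

theorem mem_verts_Hsub {S : Finset α} {i : ℕ} {p : α} :
    p ∈ (Hsub G S i).verts ↔ ∃ u ∈ Shat G S i, p ∈ (Gv G u).verts := by
  simp [Hsub]

theorem Gv_le_Hsub {S : Finset α} {i : ℕ} {u : α} (hu : u ∈ Shat G S i) :
    Gv G u ≤ Hsub G S i :=
  le_iSup₂ (f := fun w (_ : w ∈ Shat G S i) => Gv G w) u hu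

theorem mem_Shat {S : Finset α} {i : ℕ} {u : α} :
    u ∈ Shat G S i ↔ u ∈ S ∧ 4 ≤ G.degree u ∧ G.degree u ≤ i := by
  simp [Shat]

theorem Hsub_mono {S : Finset α} {i k : ℕ} (hik : i ≤ k) : Hsub G S i ≤ Hsub G S k := by
  refine iSup₂_le fun u hu => Gv_le_Hsub G ?_
  rw [mem_Shat] at hu ⊢
  exact ⟨hu.1, hu.2.1, hu.2.2.trans hik⟩

theorem Hsub_le_of_isComponent_le {S : Finset α} {i : ℕ} {K : G.Subgraph}
    (hK : ∀ C, IsComponent G (Hsub G S i) C → C ≤ K) : Hsub G S i ≤ K := by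
  refine iSup₂_le fun u hu => ?_
  obtain ⟨C, hC, huC⟩ := exists_isComponent_ge (Gv_connected u) (Gv_le_Hsub G hu)
  exact huC.trans (hK C hC)

variable {G}

theorem mem_leaves_iff_of_isComponent {S : Finset α}
    (hindep : ∀ u ∈ S, ∀ w ∈ S, ¬ G.Adj u w) {i : ℕ} {C : G.Subgraph}
    (hC : IsComponent G (Hsub G S i) C) {x : RepTree α} (hx : ∀ u ∈ x.leaves, u ∈ S)
    (hxC : RepTree.graphOf G (Gv G) x = C) {u : α} :
    u ∈ x.leaves ↔ u ∈ Shat G S i ∧ u ∈ C.verts := by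
  constructor
  · intro hu
    have huC : u ∈ C.verts := hxC ▸ RepTree.mem_verts_graphOf.2 ⟨u, hu, self_mem_Gv u⟩
    obtain ⟨w, hw, huw⟩ := (mem_verts_Hsub G).1 (hC.2.1.1 huC)
    rw [eq_of_mem_Gv hindep (hx u hu) ((mem_Shat G).1 hw).1 huw] at huC ⊢
    exact ⟨hw, huC⟩
  · rintro ⟨hu, huC⟩
    obtain ⟨w, hw, huw⟩ := RepTree.mem_verts_graphOf.1 (hxC ▸ huC)
    rwa [eq_of_mem_Gv hindep ((mem_Shat G).1 hu).1 (hx w hw) huw]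

end DegreeClasses

section Construction

variable (G : SimpleGraph V) [DecidableRel G.Adj]

theorem Shat_insert_of_lt (S : Finset V) {v : V} {k : ℕ} (hk : k < G.degree v) :
    Shat G (insert v (Shat G S (G.degree v))) k = Shat G S k := by
  ext u
  simp only [mem_Shat, Finset.mem_insert]
  constructor
  · rintro ⟨rfl | h, h4, hu⟩
    · omega
    · exact ⟨h.1, h4, hu⟩
  · rintro ⟨h, h4, hu⟩
    exact ⟨Or.inr ⟨h, h4, by omega⟩, h4, hu⟩

theorem Shat_insert_of_le (S : Finset V) {v : V} {k : ℕ} (hv : 4 ≤ G.degree v)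
    (hk : G.degree v ≤ k) :
    Shat G (insert v (Shat G S (G.degree v))) k = insert v (Shat G S (G.degree v)) := by
  ext u
  simp only [mem_Shat, Finset.mem_insert]
  constructor
  · exact fun h => h.1
  · rintro (rfl | h)
    · exact ⟨Or.inl rfl, hv, hk⟩
    · exact ⟨Or.inr h, h.2.1, h.2.2.trans hk⟩

theorem Hsub_insert_of_le (S : Finset V) {v : V} {k : ℕ} (hv : 4 ≤ G.degree v)
    (hk : G.degree v ≤ k) :
    Hsub G (insert v (Shat G S (G.degree v))) k = Gv G v ⊔ Hsub G S (G.degree v) := by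
  rw [Hsub, Shat_insert_of_le G S hv hk, Finset.iSup_insert, Hsub]

variable {G}

theorem isGood_insert_Shat {S : Finset V} (hindep : ∀ u ∈ S, ∀ w ∈ S, ¬ G.Adj u w)
    (hgood : IsGood G S) {v : V} (hv4 : 4 ≤ G.degree v) (hv9 : G.degree v ≤ 9)
    (hv : v ∉ (Hsub G S (G.degree v)).verts)
    (hfew : ∀ X : G.Subgraph, IsComponent G (Hsub G S (G.degree v)) X →
      (X.verts ∩ G.neighborSet v).ncard ≤ 2) :
    IsGood G (insert v (Shat G S (G.degree v))) := by
  classical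
  obtain ⟨T, hT, hTS, hrep, hcomp⟩ := hgood
  have hleavesS : ∀ u ∈ T.leaves, u ∈ S := fun u hu => hTS ▸ List.mem_toFinset.2 hu
  have : Nonempty (RepTree V) := ⟨T⟩
  choose! x hxT hxC using hcomp _ hv4 hv9
  generalize hH : Hsub G S (G.degree v) = H at *
  have hleaf : ∀ C, IsComponent G H C → ∀ u,
      u ∈ (x C).leaves ↔ u ∈ Shat G S (G.degree v) ∧ u ∈ C.verts := fun C hC u =>
    mem_leaves_iff_of_isComponent hindep (hH ▸ hC)
      (fun w hw => hleavesS w ((hxT C hC).sublist_leaves.subset hw)) (hxC C hC)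
  have hdisj : ∀ C D, IsComponent G H C → IsComponent G H D → C ≠ D →
      Disjoint C.verts D.verts := fun C D hC hD hne =>
    Set.disjoint_left.2 fun p hpC hpD => hne (hC.eq_of_mem hD hpC hpD)
  have hinter : ∀ C, IsComponent G H C → (Gv G v).verts ∩ C.verts = C.verts ∩ G.neighborSet v := by
    intro C hC
    ext p
    simp only [Set.mem_inter_iff, mem_Gv_verts, mem_neighborSet]
    constructor
    · rintro ⟨rfl | h, hp⟩
      · exact absurd (hC.2.1.1 hp) hv
      · exact ⟨hp, h⟩
    · exact fun h => ⟨Or.inr h.2, h.1⟩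
  let comps : Finset G.Subgraph := Finset.univ.filter (IsComponent G H)
  let meets : G.Subgraph → Prop := fun C => ∃ p ∈ (Gv G v).verts, p ∈ C.verts
  let near : List G.Subgraph := (comps.filter meets).toList
  let far : List G.Subgraph := (comps.filter fun C => ¬ meets C).toList
  have hnear : ∀ C, C ∈ near ↔ IsComponent G H C ∧ meets C := fun C => by simp [near, comps]
  have hfar : ∀ C, C ∈ far ↔ IsComponent G H C ∧ ¬ meets C := fun C => by simp [far, comps]
  have hall : ∀ C, C ∈ near ++ far ↔ IsComponent G H C := fun C => by
    rw [List.mem_append, hnear, hfar, ← and_or_left]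
    exact and_iff_left (em _)
  have hnodup : (near ++ far).Nodup := by
    refine List.nodup_append.2 ⟨Finset.nodup_toList _, Finset.nodup_toList _, ?_⟩
    rintro C hC D hD rfl
    exact ((hfar C).1 hD).2 ((hnear C).1 hC).2
  let core : RepTree V := (RepTree.leaf v).attach (near.map x)
  let tree : RepTree V := (RepTree.leaf v).attach ((near ++ far).map x)
  have hcore : RepTree.IsNode core tree := by
    simp only [tree, List.map_append, RepTree.attach_append]
    exact RepTree.isNode_attach _ _
  have hnode : ∀ C, IsComponent G H C → RepTree.IsNode (x C) tree := fun C hC =>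
    RepTree.isNode_attach_of_mem _ (List.mem_map_of_mem ((hall C).2 hC))
  have hmem : ∀ u, u ∈ tree.leaves ↔ u = v ∨ u ∈ Shat G S (G.degree v) := by
    intro u
    simp only [tree, RepTree.leaves_attach, RepTree.leaves, List.mem_append, List.mem_singleton,
      List.mem_flatMap]
    refine or_congr_right ⟨?_, fun hu => ?_⟩
    · rintro ⟨t, ht, hu⟩
      obtain ⟨C, hC, rfl⟩ := List.mem_map.1 ht
      exact ((hleaf C ((hall C).1 hC) u).1 hu).1
    · obtain ⟨C, hC, huC⟩ := exists_isComponent_ge (Gv_connected u) (hH ▸ Gv_le_Hsub G hu)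
      exact ⟨x C, List.mem_map_of_mem ((hall C).2 hC),
        (hleaf C hC u).2 ⟨hu, huC.1 (self_mem_Gv u)⟩⟩
  refine ⟨tree, ?_, ?_, ?_, ?_⟩
  · rw [RepTree.leaves_attach, List.nodup_append]
    refine ⟨by simp [RepTree.leaves], List.nodup_flatMap.2 ⟨?_, ?_⟩, ?_⟩
    · intro t ht
      obtain ⟨C, hC, rfl⟩ := List.mem_map.1 ht
      exact (hxT C ((hall C).1 hC)).sublist_leaves.nodup hT
    · refine List.pairwise_map.2 (hnodup.imp_of_mem fun {C D} hC hD hne => ?_)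
      rw [hall] at hC hD
      intro u huC huD
      exact Set.disjoint_left.1 (hdisj C D hC hD hne) ((hleaf C hC u).1 huC).2
        ((hleaf D hD u).1 huD).2
    · intro a ha b hb hab
      obtain rfl : a = v := by simpa [RepTree.leaves] using ha
      subst hab
      obtain ⟨t, ht, hu⟩ := List.mem_flatMap.1 hb
      obtain ⟨C, hC, rfl⟩ := List.mem_map.1 ht
      rw [hall] at hC
      exact hv (hC.2.1.1 ((hleaf C hC _).1 hu).2)
  · ext u
    rw [List.mem_toFinset, hmem, Finset.mem_insert]
  · refine RepTree.isRep_attach trivial ?_ ?_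
    · intro t ht
      obtain ⟨C, hC, rfl⟩ := List.mem_map.1 ht
      rw [hall] at hC
      refine ⟨(hxT C hC).isRep hrep, ?_⟩
      rw [Compatible, hxC C hC, RepTree.graphOf, hinter C hC]
      exact hfew C hC
    · refine List.pairwise_map.2 (hnodup.imp_of_mem fun {C D} hC hD hne => ?_)
      rw [hall] at hC hD
      rw [hxC C hC, hxC D hD]
      exact hdisj C D hC hD hne
  · intro k _ _ X hX
    rcases lt_or_ge k (G.degree v) with hk | hk
    · rw [Hsub, Shat_insert_of_lt G S hk, ← Hsub] at hX
      obtain ⟨y, hyT, rfl⟩ := hcomp k ‹_› ‹_› X hX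
      obtain ⟨C, hC, hyC⟩ := exists_isComponent_ge hX.1 (hX.2.1.trans (Hsub_mono G hk.le))
      rw [hH] at hC
      obtain ⟨z, hz, hzy⟩ := RepTree.exists_isNode_of_graphOf_le hindep hT hleavesS hyT (hxT C hC)
        (hyC.trans_eq (hxC C hC).symm)
      exact ⟨z, hz.trans (hnode C hC), hzy⟩
    · rw [Hsub_insert_of_le G S hv4 hk, hH] at hX
      let A : G.Subgraph := RepTree.graphOf G (Gv G) core
      let B : G.Subgraph := sSup {C | C ∈ far}
      have hmemA : ∀ p, p ∈ A.verts ↔ p ∈ (Gv G v).verts ∨ ∃ C ∈ near, p ∈ C.verts := by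
        intro p
        simp only [A, core, RepTree.mem_verts_graphOf_attach, RepTree.graphOf, List.mem_map,
          exists_exists_and_eq_and]
        refine or_congr_right (exists_congr fun C => and_congr_right fun hC => ?_)
        rw [hxC C ((hnear C).1 hC).1]
      have hmemB : ∀ p, p ∈ B.verts ↔ ∃ C ∈ far, p ∈ C.verts := by simp [B]
      have hnearA : ∀ C ∈ near, C ≤ A := fun C hC =>
        (hxC C ((hnear C).1 hC).1).symm.trans_le
          (RepTree.isNode_attach_of_mem _ (List.mem_map_of_mem hC)).graphOf_le
      have hvA : Gv G v ≤ A := (RepTree.isNode_attach (.leaf v) (near.map x)).graphOf_le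
      have hBH : B ≤ H := sSup_le fun C hC => ((hfar C).1 hC).1.2.1
      have hAH : A ≤ Gv G v ⊔ H := by
        refine RepTree.graphOf_attach_le le_sup_left fun t ht => ?_
        obtain ⟨C, hC, rfl⟩ := List.mem_map.1 ht
        have hC := ((hnear C).1 hC).1
        exact (hxC C hC).trans_le (hC.2.1.trans le_sup_right)
      have hA : A.Connected := by
        refine RepTree.graphOf_attach_connected (Gv_connected v) fun t ht => ?_
        obtain ⟨C, hC, rfl⟩ := List.mem_map.1 ht
        obtain ⟨hC, hmeets⟩ := (hnear C).1 hC
        rw [hxC C hC]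
        exact ⟨hC.1, hmeets⟩
      have hAB : Disjoint A.verts B.verts := by
        refine Set.disjoint_left.2 fun p hpA hpB => ?_
        obtain ⟨D, hD, hpD⟩ := (hmemB p).1 hpB
        rw [hfar] at hD
        rcases (hmemA p).1 hpA with hp | ⟨C, hC, hpC⟩
        · exact hD.2 ⟨p, hp, hpD⟩
        · rw [hnear] at hC
          exact hD.2 (hC.1.eq_of_mem hD.1 hpC hpD ▸ hC.2)
      have hHAB : H ≤ A ⊔ B := by
        rw [← hH]
        refine Hsub_le_of_isComponent_le G fun C hC => ?_
        rw [hH, ← hall, List.mem_append] at hC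
        exact hC.elim (fun h => (hnearA C h).trans le_sup_left)
          fun h => (le_sSup (show C ∈ {C | C ∈ far} from h)).trans le_sup_right
      have hXAB : X ≤ A ⊔ B := hX.2.1.trans (sup_le (hvA.trans le_sup_left) hHAB)
      obtain ⟨p, hp⟩ := connected_verts_nonempty hX.1
      rcases hXAB.1 hp with hpA | hpB
      · exact ⟨core, hcore,
          hX.2.2 A (le_left_of_connected_of_le_sup hX.1 hXAB hAB hp hpA) hAH hA⟩
      · have hXH : X ≤ H :=
          (le_left_of_connected_of_le_sup hX.1 (hXAB.trans_eq (sup_comm A B)) hAB.symm hp hpB).trans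
            hBH
        have hXC : IsComponent G H X :=
          ⟨hX.1, hXH, fun D hXD hDH hD => hX.2.2 D hXD (hDH.trans le_sup_right) hD⟩
        exact ⟨x X, hnode X hXC, hxC X hXC⟩

theorem phiGT_insert_Shat {S : Finset V} {v : V} (hvS : v ∉ S) (hv4 : 4 ≤ G.degree v)
    (hv9 : G.degree v ≤ 9) :
    PhiGT (phi G (insert v (Shat G S (G.degree v)))) (phi G S) := by
  refine ⟨⟨G.degree v - 4, by omega⟩, fun k hk => ?_, ?_⟩
  · have hk' : k.1 + 4 < G.degree v := by
      have : k.1 < G.degree v - 4 := hk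
      omega
    refine congrArg Finset.card (Finset.ext fun u => ?_)
    simp only [Finset.mem_filter, Finset.mem_insert, mem_Shat]
    constructor
    · rintro ⟨rfl | h, hu⟩
      · omega
      · exact ⟨h.1, hu⟩
    · rintro ⟨h, hu⟩
      exact ⟨Or.inr ⟨h, by omega, by omega⟩, hu⟩
  · refine Finset.card_lt_card (Finset.ssubset_iff_of_subset ?_ |>.2 ⟨v, ?_, ?_⟩)
    · intro u hu
      simp only [Finset.mem_filter, Finset.mem_insert, mem_Shat] at hu ⊢
      exact ⟨Or.inr ⟨hu.1, by omega, by omega⟩, hu.2⟩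
    · simp only [Finset.mem_filter, Finset.mem_insert, true_or, true_and]
      omega
    · simp [hvS]

end Construction

/-- The key construction inside the proof of Lemma 6 of the paper: if `v ∉ V(H_i)`
has degree `j ∈ [4, i]` and at most two neighbours in each component of `H_i`, then
`S' := Ŝ_j ∪ {v}` is a good independent set with all degrees at most `9`, and
`φ(S') ≻ φ(S)`. -/
theorem move_lemma_construction (G : SimpleGraph V) [DecidableRel G.Adj]
    (S : Finset V)
    (hindep : ∀ u ∈ S, ∀ w ∈ S, ¬ G.Adj u w)
    (hdeg : ∀ w ∈ S, G.degree w ≤ 9)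
    (hgood : IsGood G S)
    (i : ℕ) (hi4 : 4 ≤ i) (hi9 : i ≤ 9)
    (v : V) (hv : v ∉ (Hsub G S i).verts)
    (j : ℕ) (hj : j = G.degree v) (hj4 : 4 ≤ j) (hji : j ≤ i)
    (hfew : ∀ X : G.Subgraph, IsComponent G (Hsub G S i) X →
      (X.verts ∩ G.neighborSet v).ncard ≤ 2) :
    (∀ u ∈ insert v (Shat G S j), ∀ w ∈ insert v (Shat G S j), ¬ G.Adj u w) ∧
    (∀ w ∈ insert v (Shat G S j), G.degree w ≤ 9) ∧
    IsGood G (insert v (Shat G S j)) ∧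
    PhiGT (phi G (insert v (Shat G S j))) (phi G S) := by
  subst hj
  have hle := Hsub_mono G (S := S) hji
  have hvS : v ∉ S := fun h =>
    hv ((mem_verts_Hsub G).2 ⟨v, (mem_Shat G).2 ⟨h, hj4, hji⟩, self_mem_Gv v⟩)
  have hadj : ∀ u ∈ Shat G S (G.degree v), ¬ G.Adj u v := fun u hu huv =>
    hv (hle.1 ((mem_verts_Hsub G).2 ⟨u, hu, mem_Gv_verts.2 (Or.inr huv)⟩))
  refine ⟨fun u hu w hw => ?_, fun w hw => ?_, ?_, phiGT_insert_Shat hvS hj4 (hji.trans hi9)⟩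
  · rcases Finset.mem_insert.1 hu with rfl | hu <;> rcases Finset.mem_insert.1 hw with rfl | hw
    · exact G.irrefl
    · exact fun h => hadj w hw h.symm
    · exact hadj u hu
    · exact hindep u ((mem_Shat G).1 hu).1 w ((mem_Shat G).1 hw).1
  · rcases Finset.mem_insert.1 hw with rfl | hw
    · exact hji.trans hi9
    · exact hdeg w ((mem_Shat G).1 hw).1
  · refine isGood_insert_Shat hindep hgood hj4 (hji.trans hi9) (fun h => hv (hle.1 h)) fun X hX => ?_
    obtain ⟨C, hC, hXC⟩ := exists_isComponent_ge hX.1 (hX.2.1.trans hle)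
    exact (Set.ncard_le_ncard (Set.inter_subset_inter_left _ hXC.1)).trans (hfew C hC)
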